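/- arXiv:2109.05291 — 2 statements merged into one kernel-verified Lean document; each statement's English description precedes it below -/
import Mathlib

section
/- Let a_n denote the number of (3,0)-threshold sequences of length n and b_n the number of (3,1)-threshold sequences of length n, with the conventions a_0 = b_0 = 1. Then for every integer n ≥ 1, a_n = Σ_{h=0}^{n−1} a_h·b_{n−1−h}. -/
/-- `a n` is the number of (3,0)-threshold sequences of length `n`, with `a 0 = 1`. -/
noncomputable def a (n : ℕ) : ℕ :=
  if n = 0 then 1 else
    Set.ncard {s : Fin n → ℤ | StrictMono s ∧
      ∀ i : Fin n, 3 * ((i : ℤ) + 1) ≤ s i ∧ s i ≤ 3 * n}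

/-- `b n` is the number of (3,1)-threshold sequences of length `n`, with `b 0 = 1`. -/
noncomputable def b (n : ℕ) : ℕ :=
  if n = 0 then 1 else
    Set.ncard {s : Fin n → ℤ | StrictMono s ∧
      ∀ i : Fin n, 3 * ((i : ℤ) + 1) ≤ s i ∧ s i ≤ 3 * n + 1}

/-- Strictly increasing sequences with `3 * (i + 1) ≤ s i ≤ u` (indices starting at `0`). -/
def thresholdSet (n u : ℕ) : Set (Fin n → ℤ) :=
  {s | StrictMono s ∧ ∀ i : Fin n, 3 * ((i : ℤ) + 1) ≤ s i ∧ s i ≤ u}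

/-- The number of elements of `thresholdSet n u`. -/
noncomputable def thresholdCount (n u : ℕ) : ℕ := (thresholdSet n u).ncard

lemma thresholdSet_finite (n u : ℕ) : (thresholdSet n u).Finite := by
  refine (Set.Finite.pi' fun _ : Fin n => Set.finite_Icc (0 : ℤ) u).subset ?_
  intro s hs i
  have := hs.2 i
  exact ⟨by omega, this.2⟩

lemma thresholdCount_zero (u : ℕ) : thresholdCount 0 u = 1 := by
  have h : thresholdSet 0 u = Set.univ :=
    Set.eq_univ_of_forall fun s => ⟨fun i => i.elim0, fun i => i.elim0⟩
  simp [thresholdCount, h, Set.ncard_univ]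

lemma thresholdCount_eq_zero {n u : ℕ} (h : u < 3 * (n + 1)) :
    thresholdCount (n + 1) u = 0 := by
  have h' : thresholdSet (n + 1) u = ∅ := by
    refine Set.eq_empty_of_forall_notMem fun s hs => ?_
    have := hs.2 (Fin.last n)
    simp only [Fin.val_last] at this
    omega
  simp [thresholdCount, h']

lemma thresholdSet_succ_succ {n u : ℕ} (h : 3 * (n + 1) ≤ u + 1) :
    thresholdSet (n + 1) (u + 1) = thresholdSet (n + 1) u ∪
      (fun s : Fin n → ℤ => (Fin.snoc s ((u : ℤ) + 1) : Fin (n + 1) → ℤ)) ''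
        thresholdSet n u := by
  ext s
  constructor
  · rintro ⟨hmono, hs⟩
    have hle : ∀ i, s i ≤ s (Fin.last n) := fun i => hmono.monotone (Fin.le_last i)
    have hlast := (hs (Fin.last n)).2
    push_cast at hlast
    by_cases hu : s (Fin.last n) ≤ u
    · exact Or.inl ⟨hmono, fun i => ⟨(hs i).1, (hle i).trans hu⟩⟩
    · have hu' : s (Fin.last n) = (u : ℤ) + 1 := by omega
      refine Or.inr ⟨Fin.init s, ⟨fun i j hij => hmono (Fin.castSucc_lt_castSucc_iff.2 hij),
        fun i => ⟨(hs i.castSucc).1, ?_⟩⟩, ?_⟩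
      · have := hmono (Fin.castSucc_lt_last i)
        simp only [Fin.init]
        omega
      · simp only [← hu', Fin.snoc_init_self]
  · rintro (⟨hmono, hs⟩ | ⟨t, ⟨hmono, ht⟩, rfl⟩)
    · refine ⟨hmono, fun i => ⟨(hs i).1, ?_⟩⟩
      have := (hs i).2
      push_cast
      omega
    · refine ⟨fun i j => ?_, fun i => ?_⟩
      · induction i using Fin.lastCases with
        | last => exact fun hij => absurd (Fin.le_last j) (not_le.2 hij)
        | cast i =>
          induction j using Fin.lastCases with
          | last =>
            have := (ht i).2
            intro _
            simp only [Fin.snoc_castSucc, Fin.snoc_last]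
            omega
          | cast j =>
            intro hij
            simpa only [Fin.snoc_castSucc] using hmono (Fin.castSucc_lt_castSucc_iff.1 hij)
      · induction i using Fin.lastCases with
        | last =>
          simp only [Fin.snoc_last, Fin.val_last]
          omega
        | cast i =>
          have := ht i
          simp only [Fin.snoc_castSucc, Fin.val_castSucc]
          omega

lemma thresholdCount_succ_succ {n u : ℕ} (h : 3 * (n + 1) ≤ u + 1) :
    thresholdCount (n + 1) (u + 1) = thresholdCount (n + 1) u + thresholdCount n u := by
  have hinj : Function.Injective
      (fun s : Fin n → ℤ => (Fin.snoc s ((u : ℤ) + 1) : Fin (n + 1) → ℤ)) :=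
    fun s t hst => (Fin.snoc_injective2 hst).1
  rw [thresholdCount, thresholdSet_succ_succ h, Set.ncard_union_eq _ (thresholdSet_finite _ _)
    ((thresholdSet_finite _ _).image _), Set.ncard_image_of_injective _ hinj]
  · rfl
  · rw [Set.disjoint_left]
    rintro _ hs ⟨t, -, rfl⟩
    have := (hs.2 (Fin.last n)).2
    simp only [Fin.snoc_last] at this
    omega

/-- Convolution identity: cut the lattice path of a sequence at its last visit to height `0`. -/
lemma thresholdCount_succ_eq_sum (u : ℕ) : ∀ n : ℕ, 3 * n ≤ u →
    thresholdCount n (u + 1) = ∑ k ∈ Finset.range (n + 1),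
      thresholdCount k (3 * k) * thresholdCount (n - k) (u - 3 * k) := by
  induction u with
  | zero =>
    intro n hn
    obtain rfl : n = 0 := by omega
    simp [thresholdCount_zero]
  | succ u ih =>
    rintro (_ | n) hn
    · simp [thresholdCount_zero]
    rw [thresholdCount_succ_succ (by omega), ih n (by omega), Finset.sum_range_succ _ (n + 1)]
    have hstep : ∀ k ∈ Finset.range (n + 1),
        thresholdCount k (3 * k) * thresholdCount (n + 1 - k) (u + 1 - 3 * k) =
          thresholdCount k (3 * k) * thresholdCount (n + 1 - k) (u - 3 * k) +
          thresholdCount k (3 * k) * thresholdCount (n - k) (u - 3 * k) := by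
      intro k hk
      rw [Finset.mem_range] at hk
      rw [show n + 1 - k = n - k + 1 by omega, show u + 1 - 3 * k = u - 3 * k + 1 by omega,
        thresholdCount_succ_succ (by omega), mul_add]
    have hhead : thresholdCount (n + 1) (u + 1) =
        ∑ k ∈ Finset.range (n + 1),
          thresholdCount k (3 * k) * thresholdCount (n + 1 - k) (u - 3 * k) +
        thresholdCount (n + 1) (3 * (n + 1)) := by
      rcases (show 3 * (n + 1) ≤ u ∨ u + 1 = 3 * (n + 1) by omega) with hu | hu
      · rw [ih (n + 1) hu, Finset.sum_range_succ _ (n + 1)]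
        simp [thresholdCount_zero]
      · rw [Finset.sum_eq_zero, hu, zero_add]
        intro k hk
        rw [Finset.mem_range] at hk
        rw [show n + 1 - k = n - k + 1 by omega, thresholdCount_eq_zero (by omega), mul_zero]
    rw [hhead, Finset.sum_congr rfl hstep, Finset.sum_add_distrib]
    simp only [Nat.sub_self, thresholdCount_zero, mul_one]
    ring

lemma a_eq_thresholdCount (n : ℕ) : a n = thresholdCount n (3 * n) := by
  rcases eq_or_ne n 0 with rfl | hn
  · simp [a, thresholdCount_zero]
  · simp [a, hn, thresholdCount, thresholdSet]

lemma b_eq_thresholdCount (n : ℕ) : b n = thresholdCount n (3 * n + 1) := by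
  rcases eq_or_ne n 0 with rfl | hn
  · simp [b, thresholdCount_zero]
  · simp [b, hn, thresholdCount, thresholdSet]

/-- a_n = Σ_{h=0}^{n-1} a_h·b_{n-1-h} for n ≥ 1. -/
theorem a_eq_sum_a_mul_b (n : ℕ) (hn : 1 ≤ n) :
    a n = ∑ h ∈ Finset.range n, a h * b (n - 1 - h) := by
  obtain ⟨n, rfl⟩ : ∃ m, n = m + 1 := ⟨n - 1, by omega⟩
  rw [a_eq_thresholdCount, show 3 * (n + 1) = 3 * n + 1 + 1 + 1 by ring,
    thresholdCount_succ_succ (by omega), thresholdCount_eq_zero (by omega), zero_add,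
    thresholdCount_succ_eq_sum _ _ (by omega)]
  refine Finset.sum_congr rfl fun k hk => ?_
  rw [Finset.mem_range] at hk
  rw [a_eq_thresholdCount, b_eq_thresholdCount, Nat.add_sub_cancel,
    show 3 * n + 1 - 3 * k = 3 * (n - k) + 1 by omega]
end

section
/- Define T_n = (1/(2n+1))·binom(3n, n) and U_n = (1/(n+1))·binom(3n+1, n) as rational numbers, with T_0 = U_0 = 1. For every integer n ≥ 1, 2·Σ_{h=0}^{n−1} (1/(3h+1))·U_h·U_{n−h−1} = 4·T_n − U_n (an identity of rational numbers). -/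
/-- The Fuss–Catalan number T_n = (1/(2n+1))·binom(3n, n), as a rational number. -/
noncomputable def T (n : ℕ) : ℚ := (1 / (2 * (n : ℚ) + 1)) * Nat.choose (3 * n) n

/-- The Raney number U_n = R_n^{(3,2)} = (1/(n+1))·binom(3n+1, n), as a rational number. -/
noncomputable def U (n : ℕ) : ℚ := (1 / ((n : ℚ) + 1)) * Nat.choose (3 * n + 1) n

/-- The Raney number `x / (x + 3 n) * binom (x + 3 n) n`: the coefficient of `z ^ n` in `B ^ x`, where
`B` is the power series with `B = 1 + z * B ^ 3`. The recursion reads `B ^ (x + 1) = B ^ x + z * B ^ (x + 3)`. -/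
def raney : ℕ → ℕ → ℕ
  | 0, _ => 1
  | _ + 1, 0 => 0
  | n + 1, x + 1 => raney (n + 1) x + raney n (x + 3)
termination_by n x => (n, x)

theorem raney_zero_left (x : ℕ) : raney 0 x = 1 := by rw [raney]

theorem raney_succ_zero (n : ℕ) : raney (n + 1) 0 = 0 := by rw [raney]

theorem raney_succ_succ (n x : ℕ) :
    raney (n + 1) (x + 1) = raney (n + 1) x + raney n (x + 3) := by rw [raney]

theorem add_mul_raney (n x : ℕ) : (x + 3 * n) * raney n x = x * (x + 3 * n).choose n := by
  induction n generalizing x with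
  | zero => simp [raney_zero_left]
  | succ n ihn =>
    induction x with
    | zero => simp [raney_succ_zero]
    | succ x ihx =>
      have ih := ihn (x + 3)
      have hC := Nat.choose_succ_right_eq (x + 3 * n + 3) n
      rw [show x + 3 * n + 3 - n = x + 2 * n + 3 by omega] at hC
      rw [show x + 3 * (n + 1) = x + 3 * n + 3 by ring] at ihx
      rw [show x + 3 + 3 * n = x + 3 * n + 3 by ring] at ih
      rw [show x + 1 + 3 * (n + 1) = x + 3 * n + 3 + 1 by ring, Nat.choose_succ_succ',
        raney_succ_succ]
      apply Nat.eq_of_mul_eq_mul_left (show 0 < x + 3 * n + 3 by omega)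
      zify at *
      linear_combination (x + 3 * n + 4 : ℤ) * (ihx + ih) - 3 * hC

theorem sum_raney_mul_raney (n x y : ℕ) :
    ∑ p ∈ Finset.HasAntidiagonal.antidiagonal n, raney p.1 x * raney p.2 y = raney n (x + y) := by
  induction n generalizing x with
  | zero => simp [raney_zero_left]
  | succ n ihn =>
    induction x with
    | zero => simp [Finset.Nat.sum_antidiagonal_succ, raney_succ_zero, raney_zero_left]
    | succ x ihx =>
      rw [Finset.Nat.sum_antidiagonal_succ] at ihx ⊢
      simp only [raney_zero_left, raney_succ_succ, add_mul, Finset.sum_add_distrib] at ihx ⊢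
      rw [← add_assoc, ihx, ihn, show x + 1 + y = x + y + 1 by ring, raney_succ_succ,
        show x + 3 + y = x + y + 3 by ring]

theorem T_eq_raney (n : ℕ) : T n = raney n 1 := by
  have h := add_mul_raney n 1
  have hC := Nat.add_one_mul_choose_eq (3 * n) n
  have hS := Nat.choose_succ_right_eq (3 * n + 1) n
  rw [show 3 * n + 1 - n = 2 * n + 1 by omega] at hS
  rw [add_comm 1 (3 * n)] at h
  have h1 : (3 * n + 1 : ℚ) ≠ 0 := by positivity
  have h2 : (2 * n + 1 : ℚ) ≠ 0 := by positivity
  qify at h hC hS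
  rw [T, one_div, inv_mul_eq_iff_eq_mul₀ h2]
  apply mul_left_cancel₀ h1
  linear_combination hC + hS - (2 * n + 1 : ℚ) * h

theorem U_eq_raney (n : ℕ) : U n = raney n 2 := by
  have h := add_mul_raney n 2
  have hC := Nat.add_one_mul_choose_eq (3 * n + 1) n
  have hS := Nat.choose_succ_right_eq (3 * n + 2) n
  rw [show 3 * n + 2 - n = 2 * n + 2 by omega] at hS
  rw [add_comm 2 (3 * n)] at h
  have h1 : (3 * n + 2 : ℚ) ≠ 0 := by positivity
  have h2 : (n + 1 : ℚ) ≠ 0 := by positivity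
  qify at h hC hS
  rw [U, one_div, inv_mul_eq_iff_eq_mul₀ h2]
  apply mul_left_cancel₀ h1
  linear_combination hC + hS - (n + 1 : ℚ) * h

theorem add_one_mul_U (n : ℕ) : ((n : ℚ) + 1) * U n = (3 * n + 1) * T n := by
  have hC := Nat.choose_mul_succ_eq (3 * n) n
  rw [show 3 * n + 1 - n = 2 * n + 1 by omega] at hC
  qify at hC
  rw [U, T]
  field_simp
  linear_combination -hC

/-- 2·Σ_{h=0}^{n-1} (1/(3h+1))·U_h·U_{n-h-1} = 4·T_n − U_n for n ≥ 1. -/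
theorem sum_U_identity (n : ℕ) (hn : 1 ≤ n) :
    2 * ∑ h ∈ Finset.range n, (1 / (3 * (h : ℚ) + 1)) * U h * U (n - h - 1) =
      4 * T n - U n := by
  obtain ⟨m, rfl⟩ := Nat.exists_eq_add_of_le' hn
  have hU (h : ℕ) : 2 * ((1 / (3 * (h : ℚ) + 1)) * U h) = 3 * T h - U h := by
    field_simp
    linear_combination 3 * add_one_mul_U h
  have hTU := sum_raney_mul_raney m 1 2
  have hUU := sum_raney_mul_raney m 2 2
  have hT := raney_succ_succ m 0
  have hU' := raney_succ_succ m 1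
  rw [raney_succ_zero] at hT
  rw [Finset.Nat.sum_antidiagonal_eq_sum_range_succ_mk] at hTU hUU
  qify at hTU hUU hT hU'
  simp only [← T_eq_raney, ← U_eq_raney] at hTU hUU
  norm_num [← T_eq_raney, ← U_eq_raney] at hT hU'
  calc 2 * ∑ h ∈ Finset.range (m + 1), (1 / (3 * (h : ℚ) + 1)) * U h * U (m + 1 - h - 1)
      = 3 * ∑ h ∈ Finset.range (m + 1), T h * U (m - h) -
          ∑ h ∈ Finset.range (m + 1), U h * U (m - h) := by
        rw [Finset.mul_sum, Finset.mul_sum, ← Finset.sum_sub_distrib]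
        refine Finset.sum_congr rfl fun h _ => ?_
        rw [show m + 1 - h - 1 = m - h by omega]
        linear_combination U (m - h) * hU h
    _ = 4 * T (m + 1) - U (m + 1) := by
        rw [hTU, hUU]
        linear_combination hU' - 3 * hT
end
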